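/- Soundness of the range-search pruning: for all natural numbers k, v, vmin, vmax with vmin ≤ v ≤ vmax, the encoded value Szudzik(k, v) lies in the search range [Szudzik(k, vmin), Szudzik(k, vmax)]; that is, Szudzik(k, vmin) ≤ Szudzik(k, v) ≤ Szudzik(k, vmax). Hence every walk triplet with key k whose next-vertex identifier lies between vmin and vmax is found inside this range. -/

import Mathlib

/-- The Szudzik pairing function: `Szudzik(x,y) = y² + x` if `x < y`,
and `x² + x + y` otherwise. -/
def szudzik (x y : ℕ) : ℕ := if x < y then y ^ 2 + x else x ^ 2 + x + y

theorem szudzik_eq_pair (x y : ℕ) : szudzik x y = Nat.pair x y := by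
  simp only [szudzik, Nat.pair, sq]

/-- The Szudzik pairing function is strictly increasing in its second argument. -/
theorem szudzik_strictMono_right (k : ℕ) : StrictMono (szudzik k) := fun _ _ h => by
  simpa only [szudzik_eq_pair] using Nat.pair_lt_pair_right k h

/-- Soundness of range-search pruning: if `vmin ≤ v ≤ vmax` then the encoded
value `Szudzik(k, v)` lies in the search range
`[Szudzik(k, vmin), Szudzik(k, vmax)]`. -/
theorem szudzik_mem_search_range (k v vmin vmax : ℕ)
    (h₁ : vmin ≤ v) (h₂ : v ≤ vmax) :
    szudzik k vmin ≤ szudzik k v ∧ szudzik k v ≤ szudzik k vmax :=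
  ⟨(szudzik_strictMono_right k).monotone h₁, (szudzik_strictMono_right k).monotone h₂⟩
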